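/- Let a ⊆ E(ℝⁿ) be a Łojasiewicz ideal. Then I(Z(a)) equals the saturation of the Łojasiewicz radical of a: {g ∈ E(ℝⁿ) : g vanishes identically on Z(a)} = {g ∈ E(ℝⁿ) : for every x ∈ ℝⁿ there exists h ∈ E(ℝⁿ) with h(x) ≠ 0 and h·g ∈ √[Ł]a}. -/

import Mathlib

/-- The ring `E(ℝⁿ)` of real-valued smooth (`C^∞`) functions on `ℝⁿ`,
as an `ℝ`-subalgebra of all functions `ℝⁿ → ℝ`. -/
def SmoothFns (n : ℕ) : Subalgebra ℝ ((Fin n → ℝ) → ℝ) where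
  carrier := {f | ContDiff ℝ (⊤ : ℕ∞) f}
  mul_mem' := fun {a b} (hf : ContDiff ℝ (⊤ : ℕ∞) a) (hg : ContDiff ℝ (⊤ : ℕ∞) b) =>
    show ContDiff ℝ (⊤ : ℕ∞) (a * b) from hf.mul hg
  add_mem' := fun {a b} (hf : ContDiff ℝ (⊤ : ℕ∞) a) (hg : ContDiff ℝ (⊤ : ℕ∞) b) =>
    show ContDiff ℝ (⊤ : ℕ∞) (a + b) from hf.add hg
  algebraMap_mem' := fun _r => show ContDiff ℝ (⊤ : ℕ∞) _ from contDiff_const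

/-- The zero set `Z(a)` of an ideal of smooth functions. -/
def ZeroSet (n : ℕ) (a : Ideal (SmoothFns n)) : Set (Fin n → ℝ) :=
  {x | ∀ h ∈ a, h.1 x = 0}

/-- An ideal `a ⊆ E(ℝⁿ)` is a Łojasiewicz ideal if it is finitely generated and
contains an element `f` with `|f(x)| ≥ c · dist(x, Z(a))^m` near every compact set. -/
def IsLojasiewiczIdeal (n : ℕ) (a : Ideal (SmoothFns n)) : Prop :=
  (∃ l : ℕ, ∃ F : Fin l → SmoothFns n, a = Ideal.span (Set.range F)) ∧
  ∃ f ∈ a, ∀ K : Set (Fin n → ℝ), IsCompact K →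
    ∃ c : ℝ, 0 < c ∧ ∃ m : ℕ, 1 ≤ m ∧ ∃ V : Set (Fin n → ℝ), IsOpen V ∧ K ⊆ V ∧
      ∀ x ∈ V, c * Metric.infDist x (ZeroSet n a) ^ m ≤ |f.1 x|

/-- The Łojasiewicz radical `√[Ł]a` of an ideal `a ⊆ E(ℝⁿ)`. -/
def LRadical (n : ℕ) (a : Ideal (SmoothFns n)) : Set (SmoothFns n) :=
  {g | ∃ f ∈ a, ∃ m : ℕ, 1 ≤ m ∧ ∀ x : Fin n → ℝ, f.1 x - g.1 x ^ (2 * m) ≥ 0}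

/-- The zero set of an ideal of smooth functions is closed. -/
theorem isClosed_zeroSet (n : ℕ) (a : Ideal (SmoothFns n)) : IsClosed (ZeroSet n a) := by
  have : ZeroSet n a = ⋂ h ∈ a, {x | h.1 x = 0} := by
    ext x
    simp [ZeroSet]
  rw [this]
  refine isClosed_biInter fun h _ => ?_
  have hh : ContDiff ℝ (⊤ : ℕ∞) h.1 := h.2
  exact isClosed_eq hh.continuous continuous_const

/-- A smooth function vanishing on a closed set `Z` is bounded near a point of `Z` by a multiple
of the distance to `Z`. -/
theorem exists_abs_le_mul_infDist {n : ℕ} {Z : Set (Fin n → ℝ)} (hZ : IsClosed Z)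
    {g : (Fin n → ℝ) → ℝ} (hg : ContDiff ℝ (⊤ : ℕ∞) g) (hgZ : ∀ z ∈ Z, g z = 0)
    {x : Fin n → ℝ} (hx : x ∈ Z) :
    ∃ L : ℝ, 0 ≤ L ∧ ∃ r : ℝ, 0 < r ∧
      ∀ y ∈ Metric.ball x r, |g y| ≤ L * Metric.infDist y Z := by
  have hg1 : ContDiffAt ℝ 1 g x := (hg.of_le (by exact_mod_cast le_top)).contDiffAt
  obtain ⟨L, s, hs, hL⟩ := hg1.exists_lipschitzOnWith
  obtain ⟨ε, hε, hεs⟩ := Metric.mem_nhds_iff.1 hs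
  refine ⟨L, L.2, ε / 2, by positivity, fun y hy => ?_⟩
  obtain ⟨z, hz, hyz⟩ := hZ.exists_infDist_eq_dist ⟨x, hx⟩ y
  have hyx : dist y x < ε / 2 := hy
  have hle : dist y z ≤ dist y x := hyz ▸ Metric.infDist_le_dist_of_mem hx
  have hzx : dist z x < ε := by
    have := dist_triangle_left z x y
    linarith
  have h := hL.dist_le_mul y (hεs (Metric.ball_subset_ball (by linarith) hy)) z (hεs hzx)
  rwa [hgZ z hz, Real.dist_0_eq_abs, ← hyz] at h

/-- If a member `f` of `a` dominates a power of the distance to `Z(a)` near `x ∈ Z(a)`, then every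
smooth `g` vanishing on `Z(a)` has a multiple by a bump function at `x` in the Łojasiewicz
radical. -/
theorem exists_mul_mem_LRadical_of_mem_zeroSet {n : ℕ} {a : Ideal (SmoothFns n)}
    {f g : SmoothFns n} (hf : f ∈ a) (hg : ∀ z ∈ ZeroSet n a, g.1 z = 0)
    {x : Fin n → ℝ} (hx : x ∈ ZeroSet n a) {c : ℝ} (hc : 0 < c) {m : ℕ} (hm : 1 ≤ m)
    {V : Set (Fin n → ℝ)} (hV : V ∈ nhds x)
    (hfV : ∀ y ∈ V, c * Metric.infDist y (ZeroSet n a) ^ m ≤ |f.1 y|) :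
    ∃ h : SmoothFns n, h.1 x ≠ 0 ∧ h * g ∈ LRadical n a := by
  obtain ⟨L, hL, r, hr, hgL⟩ := exists_abs_le_mul_infDist (isClosed_zeroSet n a) g.2 hg hx
  obtain ⟨δ, hδ, hδV⟩ := Metric.mem_nhds_iff.1 hV
  have hρ : 0 < min r δ := lt_min hr hδ
  let b : ContDiffBump x := ⟨min r δ / 2, min r δ, by positivity, by linarith⟩
  let C : ℝ := (L ^ m / c) ^ 2
  refine ⟨⟨b, b.contDiff⟩, ?_, algebraMap ℝ (SmoothFns n) C * (f * f),
    a.mul_mem_left _ (a.mul_mem_left _ hf), m, hm, fun y => ?_⟩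
  · exact (b.pos_of_mem_ball (Metric.mem_ball_self hρ)).ne'
  · change C * (f.1 y * f.1 y) - (b y * g.1 y) ^ (2 * m) ≥ 0
    by_cases hy : y ∈ Metric.ball x (min r δ)
    · have hyr : y ∈ Metric.ball x r := Metric.ball_subset_ball (min_le_left _ _) hy
      have hyV : y ∈ V := hδV (Metric.ball_subset_ball (min_le_right _ _) hy)
      have hbg : |b y * g.1 y| ≤ L * Metric.infDist y (ZeroSet n a) := by
        rw [abs_mul, abs_of_nonneg b.nonneg]
        exact (mul_le_of_le_one_left (abs_nonneg _) b.le_one).trans (hgL y hyr)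
      have hpow : |b y * g.1 y| ^ m ≤ L ^ m / c * |f.1 y| := by
        calc |b y * g.1 y| ^ m ≤ (L * Metric.infDist y (ZeroSet n a)) ^ m := by gcongr
          _ = L ^ m / c * (c * Metric.infDist y (ZeroSet n a) ^ m) := by
            rw [mul_pow]
            field_simp
          _ ≤ L ^ m / c * |f.1 y| := by
            gcongr
            exact hfV y hyV
      have hsq : (b y * g.1 y) ^ (2 * m) = (|b y * g.1 y| ^ m) ^ 2 := by
        rw [← pow_mul, mul_comm m 2, pow_mul, pow_mul, sq_abs]
      have hle : (|b y * g.1 y| ^ m) ^ 2 ≤ (L ^ m / c * |f.1 y|) ^ 2 := by gcongr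
      rw [mul_pow, sq_abs] at hle
      rw [hsq, ge_iff_le, sub_nonneg, ← pow_two]
      exact hle
    · have hb : b y = 0 := b.zero_of_le_dist (not_lt.1 hy)
      rw [hb, zero_mul, zero_pow (by omega), sub_zero]
      exact mul_nonneg (sq_nonneg _) (mul_self_nonneg _)

/-- For a Łojasiewicz ideal `a ⊆ E(ℝⁿ)`, `I(Z(a))` equals the saturation of the
Łojasiewicz radical `√[Ł]a`. -/
theorem vanishing_ideal_eq_saturation_LRadical (n : ℕ) (a : Ideal (SmoothFns n))
    (hLoj : IsLojasiewiczIdeal n a) :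
    {g : SmoothFns n | ∀ x ∈ ZeroSet n a, g.1 x = 0}
      = {g : SmoothFns n | ∀ x : Fin n → ℝ, ∃ h : SmoothFns n,
          h.1 x ≠ 0 ∧ h * g ∈ LRadical n a} := by
  ext g
  constructor
  · intro hg x
    by_cases hx : x ∈ ZeroSet n a
    · obtain ⟨-, f, hf, hK⟩ := hLoj
      obtain ⟨c, hc, m, hm, V, hVo, hxV, hfV⟩ := hK {x} isCompact_singleton
      exact exists_mul_mem_LRadical_of_mem_zeroSet hf hg hx hc hm
        (hVo.mem_nhds (hxV rfl)) hfV
    · obtain ⟨p, hp, hpx⟩ : ∃ p ∈ a, p.1 x ≠ 0 := by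
        simpa [ZeroSet] using hx
      refine ⟨p, hpx, (p * g) ^ 2, a.pow_mem_of_mem (a.mul_mem_right g hp) 2 two_pos, 1, le_rfl,
        fun y => ?_⟩
      exact (sub_self ((p * g).1 y ^ 2)).ge
  · intro hg x hx
    obtain ⟨h, hhx, f, hf, m, hm, hle⟩ := hg x
    have hx' := hle x
    rw [hx f hf, zero_sub, ge_iff_le, neg_nonneg] at hx'
    have h0 : (h * g).1 x = 0 :=
      eq_zero_of_pow_eq_zero (hx'.antisymm ((even_two_mul m).pow_nonneg _))
    exact (mul_eq_zero.1 (show h.1 x * g.1 x = 0 from h0)).resolve_left hhx
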